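/- Let V and E be finite types, src, tgt : E → V, w : E → ℤ, fix a source node s, let n = |V|, and let d : ℕ → V → WithTop ℤ be the Bellman-Ford distance function. Suppose no negative-weight cycle is reachable from s. Then for every node v: (1) d (n−1) v is a lower bound on the weight of every walk from s to v; (2) if v is reachable from s, then there exists a walk from s to v whose weight equals d (n−1) v; and (3) d (n−1) v = ⊤ if and only if v is not reachable from s. In other words, d (n−1) v is the minimum weight over all walks from s to v. -/

import Mathlib

namespace BFPaper

variable {V E : Type*}

/-- `IsWalk src tgt u v es` : the list of edges `es` forms a walk from `u` to `v`
in the directed multigraph given by source and target maps `src tgt : E → V`. -/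
inductive IsWalk (src tgt : E → V) : V → V → List E → Prop
  | nil (u : V) : IsWalk src tgt u u []
  | cons {v : V} (e : E) {es : List E} (h : IsWalk src tgt (tgt e) v es) :
      IsWalk src tgt (src e) v (e :: es)

/-- The weight of a walk: the sum of the weights of its edges. -/
def weight (w : E → ℤ) (es : List E) : ℤ := (es.map w).sum

/-- `v` is reachable from `s` if there is a walk from `s` to `v`. -/
def Reachable (src tgt : E → V) (s v : V) : Prop :=
  ∃ es : List E, IsWalk src tgt s v es

/-- There is a negative-weight cycle reachable from `s`. -/
def HasNegCycleFrom (src tgt : E → V) (w : E → ℤ) (s : V) : Prop :=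
  ∃ (u : V) (es : List E), es ≠ [] ∧ IsWalk src tgt u u es ∧
    weight w es < 0 ∧ Reachable src tgt s u

/-- The Bellman-Ford distance function `d : ℕ → V → WithTop ℤ`. -/
def bfDist [Fintype E] [DecidableEq V] (src tgt : E → V) (w : E → ℤ) (s : V) :
    ℕ → V → WithTop ℤ
  | 0 => fun v => if v = s then (0 : WithTop ℤ) else ⊤
  | (k+1) => fun v =>
      min (bfDist src tgt w s k v)
        (Finset.univ.inf fun e : E =>
          if tgt e = v then bfDist src tgt w s k (src e) + (w e : WithTop ℤ) else ⊤)

end BFPaper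

namespace BFPaper

variable {V E : Type*} {src tgt : E → V} {w : E → ℤ}

theorem isWalk_nil_iff {u v : V} : IsWalk src tgt u v [] ↔ u = v :=
  ⟨fun h => by cases h; rfl, fun h => h ▸ .nil u⟩

theorem isWalk_cons_iff {u v : V} {e : E} {es : List E} :
    IsWalk src tgt u v (e :: es) ↔ src e = u ∧ IsWalk src tgt (tgt e) v es := by
  constructor
  · intro h
    cases h with
    | cons e h => exact ⟨rfl, h⟩
  · rintro ⟨rfl, h⟩
    exact .cons e h

theorem isWalk_append_iff {u v : V} {P Q : List E} :
    IsWalk src tgt u v (P ++ Q) ↔ ∃ x, IsWalk src tgt u x P ∧ IsWalk src tgt x v Q := by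
  induction P generalizing u with
  | nil => simp [isWalk_nil_iff]
  | cons e P ih => simp [isWalk_cons_iff, ih, and_assoc]

theorem isWalk_concat_iff {u v : V} {P : List E} {e : E} :
    IsWalk src tgt u v (P ++ [e]) ↔ IsWalk src tgt u (src e) P ∧ tgt e = v := by
  simp [isWalk_append_iff, isWalk_cons_iff, isWalk_nil_iff]

theorem IsWalk.endpoint_unique {u x y : V} {P : List E} (hx : IsWalk src tgt u x P)
    (hy : IsWalk src tgt u y P) : x = y := by
  induction P generalizing u with
  | nil => exact (isWalk_nil_iff.1 hx).symm.trans (isWalk_nil_iff.1 hy)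
  | cons e P ih => exact ih (isWalk_cons_iff.1 hx).2 (isWalk_cons_iff.1 hy).2

theorem weight_append (P Q : List E) : weight w (P ++ Q) = weight w P + weight w Q := by
  simp [weight]

/-- A walk with at least `|V|` edges decomposes around a nonempty cycle. -/
theorem IsWalk.exists_cycle [Fintype V] {u v : V} {P : List E} (hP : IsWalk src tgt u v P)
    (hlen : Fintype.card V ≤ P.length) :
    ∃ (x : V) (A C B : List E), P = A ++ (C ++ B) ∧ C ≠ [] ∧ IsWalk src tgt u x A ∧
      IsWalk src tgt x x C ∧ IsWalk src tgt x v B := by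
  have hsplit (i : Fin (P.length + 1)) :
      ∃ x, IsWalk src tgt u x (P.take i) ∧ IsWalk src tgt x v (P.drop i) := by
    rw [← isWalk_append_iff, List.take_append_drop]
    exact hP
  choose f hf₁ hf₂ using hsplit
  obtain ⟨i, j, hne, hij⟩ := Fintype.exists_ne_map_eq_of_card_lt f (by simp; omega)
  wlog hlt : i < j generalizing i j
  · exact this j i hne.symm hij.symm (lt_of_le_of_ne (not_lt.1 hlt) hne.symm)
  have hlt' : (i : ℕ) < j := hlt
  have hj := j.isLt
  have htake : P.take j = P.take i ++ (P.take j).drop i := by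
    conv_lhs => rw [← List.take_append_drop i (P.take j), List.take_take, min_eq_left hlt'.le]
  obtain ⟨x, hx, hC⟩ := isWalk_append_iff.1 (htake ▸ hf₁ j)
  obtain rfl := hx.endpoint_unique (hf₁ i)
  refine ⟨f i, P.take i, (P.take j).drop i, P.drop j, ?_, ?_, hf₁ i, ?_, ?_⟩
  · rw [← List.append_assoc, ← htake, List.take_append_drop]
  · rw [← List.length_pos_iff]
    simp only [List.length_drop, List.length_take]
    omega
  · rwa [← hij] at hC
  · rw [hij]
    exact hf₂ j

/-- Without reachable negative cycles, cycles can be cut out of a walk without raising its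
weight. -/
theorem IsWalk.exists_short [Fintype V] {s v : V} (hnc : ¬ HasNegCycleFrom src tgt w s)
    {P : List E} (hP : IsWalk src tgt s v P) :
    ∃ Q, IsWalk src tgt s v Q ∧ Q.length < Fintype.card V ∧ weight w Q ≤ weight w P := by
  induction hn : P.length using Nat.strong_induction_on generalizing P with
  | _ n ih =>
    by_cases hlen : P.length < Fintype.card V
    · exact ⟨P, hP, hlen, le_rfl⟩
    obtain ⟨x, A, C, B, rfl, hC0, hA, hC, hB⟩ := hP.exists_cycle (not_lt.1 hlen)
    have hCw : 0 ≤ weight w C := not_lt.1 fun h => hnc ⟨x, C, hC0, hC, h, A, hA⟩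
    have hC1 := List.length_pos_iff.2 hC0
    simp only [List.length_append] at hn
    obtain ⟨Q, hQ, hQl, hQw⟩ := ih (A ++ B).length (by simp only [List.length_append]; omega)
      (isWalk_append_iff.2 ⟨x, hA, hB⟩) rfl
    refine ⟨Q, hQ, hQl, hQw.trans ?_⟩
    simp only [weight_append]
    omega

variable [Fintype E] [DecidableEq V]

theorem bfDist_le_weight {s v : V} {k : ℕ} {P : List E} (hP : IsWalk src tgt s v P)
    (hk : P.length ≤ k) : bfDist src tgt w s k v ≤ (weight w P : WithTop ℤ) := by
  induction k generalizing v P with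
  | zero =>
    obtain rfl := List.length_eq_zero_iff.1 (Nat.le_zero.1 hk)
    obtain rfl := isWalk_nil_iff.1 hP
    simp [bfDist, weight]
  | succ k ih =>
    rcases P.eq_nil_or_concat' with rfl | ⟨P, e, rfl⟩
    · exact (min_le_left _ _).trans (ih hP (Nat.zero_le k))
    · obtain ⟨hP', rfl⟩ := isWalk_concat_iff.1 hP
      refine (min_le_right _ _).trans ((Finset.inf_le (Finset.mem_univ e)).trans ?_)
      rw [if_pos rfl, weight_append, WithTop.coe_add]
      simp only [List.length_append, List.length_singleton] at hk
      have hle := ih hP' (Nat.le_of_succ_le_succ hk)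
      rw [show weight w [e] = w e by simp [weight]]
      gcongr

theorem exists_isWalk_weight_eq_bfDist {s v : V} {k : ℕ} (h : bfDist src tgt w s k v ≠ ⊤) :
    ∃ P, IsWalk src tgt s v P ∧ (weight w P : WithTop ℤ) = bfDist src tgt w s k v := by
  induction k generalizing v with
  | zero =>
    have hv : v = s := by
      by_contra hv
      exact h (if_neg hv)
    exact ⟨[], isWalk_nil_iff.2 hv.symm, by simp [bfDist, hv, weight]⟩
  | succ k ih =>
    simp only [bfDist] at h ⊢
    rcases min_choice (bfDist src tgt w s k v) (Finset.univ.inf fun e : E =>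
      if tgt e = v then bfDist src tgt w s k (src e) + (w e : WithTop ℤ) else ⊤) with hm | hm
    · rw [hm] at h ⊢
      exact ih h
    · rw [hm] at h ⊢
      have hne : (Finset.univ : Finset E).Nonempty := by
        by_contra hE
        exact h (by rw [Finset.not_nonempty_iff_eq_empty.1 hE, Finset.inf_empty])
      obtain ⟨e, -, he⟩ := Finset.exists_mem_eq_inf Finset.univ hne fun e : E =>
        if tgt e = v then bfDist src tgt w s k (src e) + (w e : WithTop ℤ) else ⊤
      rw [he] at h ⊢
      have hev : tgt e = v := by
        by_contra hev
        exact h (if_neg hev)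
      rw [if_pos hev] at h ⊢
      obtain ⟨P, hP, hPw⟩ := ih (WithTop.add_ne_top.1 h).1
      refine ⟨P ++ [e], isWalk_concat_iff.2 ⟨hP, hev⟩, ?_⟩
      rw [weight_append, WithTop.coe_add, hPw]
      simp [weight]

end BFPaper

/-- Correctness of Bellman-Ford: if no negative-weight cycle is reachable from `s`,
then `d (|V| - 1) v` is the minimum weight over all walks from `s` to `v`. -/
theorem bfDist_correct_of_no_negCycle
    (V E : Type*) [Fintype V] [Fintype E] [DecidableEq V]
    (src tgt : E → V) (w : E → ℤ) (s : V)
    (hnc : ¬ BFPaper.HasNegCycleFrom src tgt w s) :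
    ∀ v : V,
      (∀ P : List E, BFPaper.IsWalk src tgt s v P →
          BFPaper.bfDist src tgt w s (Fintype.card V - 1) v ≤
            (BFPaper.weight w P : WithTop ℤ)) ∧
      (BFPaper.Reachable src tgt s v →
          ∃ P : List E, BFPaper.IsWalk src tgt s v P ∧
            (BFPaper.weight w P : WithTop ℤ) =
              BFPaper.bfDist src tgt w s (Fintype.card V - 1) v) ∧
      (BFPaper.bfDist src tgt w s (Fintype.card V - 1) v = ⊤ ↔
          ¬ BFPaper.Reachable src tgt s v) := by
  intro v
  have hle (P : List E) (hP : BFPaper.IsWalk src tgt s v P) :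
      BFPaper.bfDist src tgt w s (Fintype.card V - 1) v ≤ (BFPaper.weight w P : WithTop ℤ) := by
    obtain ⟨Q, hQ, hQl, hQw⟩ := hP.exists_short hnc
    exact (BFPaper.bfDist_le_weight hQ (by omega)).trans (WithTop.coe_le_coe.2 hQw)
  have hne (hr : BFPaper.Reachable src tgt s v) :
      BFPaper.bfDist src tgt w s (Fintype.card V - 1) v ≠ ⊤ :=
    let ⟨P, hP⟩ := hr
    ne_top_of_le_ne_top WithTop.coe_ne_top (hle P hP)
  refine ⟨hle, fun hr => BFPaper.exists_isWalk_weight_eq_bfDist (hne hr),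
    fun h hr => hne hr h, fun h => ?_⟩
  by_contra htop
  obtain ⟨P, hP, -⟩ := BFPaper.exists_isWalk_weight_eq_bfDist htop
  exact h ⟨P, hP⟩
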